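/- In the setting of the previous approximation bound on cells away from the decision boundary (pairwise disjoint Borel cells A_j ⊆ B_r(z_j), each intersecting only one class, with class sets C_j, signs σ_j, λ^d(B_{ω₊}(z_j) ∖ C_j) = 0, ω₊ = ω₋ + r, γ_j > 0, γ_max = max_j γ_j, g_j := (π·γ_j²)^{−d/4}·1_{B_{ω₊}(z_j) ∩ C_j}, f*(x) := 1 if η(x) ≥ 1/2 and −1 otherwise), assume in addition that μ has margin-noise exponent β > 0 with constant c_MNE > 0 and that there is s > 0 with A_j ⊆ {x ∈ X : Δ_η(x) ≤ s} for every j ∈ J. Then for every ξ > 0, Σ_{j∈J} ∫_{A_j} |σ_j·(K_{γ_j} ∗ g_j)(x) − f*(x)|·|2η(x) − 1| dμ(x) ≤ (2^{−ξ}·Γ(d/2 + ξ)/Γ(d/2)) · (γ_max/ω₋)^{2ξ} · (c_MNE·s)^β. -/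

import Mathlib

open Set Metric MeasureTheory ENNReal

open Classical in
/-- The distance to the decision boundary `Δ_η` associated to a posterior probability
`η` on `X`. -/
noncomputable def deltaEta {E : Type*} [PseudoEMetricSpace E]
    (X : Set E) (η : E → ℝ) (x : E) : ℝ≥0∞ :=
  if x ∈ X ∧ 1/2 < η x then EMetric.infEdist x {y ∈ X | η y < 1/2}
  else if x ∈ X ∧ η x < 1/2 then EMetric.infEdist x {y ∈ X | 1/2 < η y}
  else 0

/-- The function `K_γ(u) = (2/(√π γ))^{d/2} exp(-2‖u‖²/γ²)`. -/
noncomputable def gaussK (d : ℕ) (γ : ℝ) (u : EuclideanSpace ℝ (Fin d)) : ℝ :=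
  (2 / (Real.sqrt Real.pi * γ)) ^ ((d : ℝ) / 2) * Real.exp (-2 * ‖u‖ ^ 2 / γ ^ 2)

/-- The convolution `(K_γ ∗ g)(x) = ∫ K_γ(x - y) g(y) dλ^d(y)`. -/
noncomputable def convK (d : ℕ) (γ : ℝ) (g : EuclideanSpace ℝ (Fin d) → ℝ)
    (x : EuclideanSpace ℝ (Fin d)) : ℝ :=
  ∫ y, gaussK d γ (x - y) * g y

/-- The function `g = (π γ²)^{-d/4} · 1_{B_ρ(z) ∩ C}`. -/
noncomputable def plateauFun (d : ℕ) (γ ρ : ℝ) (z : EuclideanSpace ℝ (Fin d))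
    (C : Set (EuclideanSpace ℝ (Fin d))) (y : EuclideanSpace ℝ (Fin d)) : ℝ :=
  (Real.pi * γ ^ 2) ^ (-(d : ℝ) / 4) * (closedBall z ρ ∩ C).indicator (fun _ => (1 : ℝ)) y

lemma pow_sub_one_smul_rpow_mul_exp {n : ℕ} (hn : 1 ≤ n) {p b y : ℝ} (hy : 0 < y) :
    y ^ (n - 1) • (y ^ p * Real.exp (-b * y ^ 2))
      = y ^ ((n : ℝ) - 1 + p) * Real.exp (-b * y ^ (2 : ℝ)) := by
  rw [Real.rpow_add hy, smul_eq_mul, ← mul_assoc, Real.rpow_two,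
    ← Real.rpow_natCast y (n - 1), Nat.cast_sub hn, Nat.cast_one]

section GaussianMoments

variable {E : Type*} [NormedAddCommGroup E] [InnerProductSpace ℝ E] [FiniteDimensional ℝ E]
  [MeasurableSpace E] [BorelSpace E] [Nontrivial E]

lemma integrable_norm_rpow_mul_exp_neg_mul_sq {p b : ℝ} (hp : 0 ≤ p) (hb : 0 < b) :
    Integrable fun x : E => ‖x‖ ^ p * Real.exp (-b * ‖x‖ ^ 2) := by
  have hd : (1 : ℝ) ≤ Module.finrank ℝ E := by exact_mod_cast Module.finrank_pos (R := ℝ) (M := E)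
  refine (integrable_fun_norm_addHaar (E := E) volume
    (f := fun y : ℝ => y ^ p * Real.exp (-b * y ^ 2))).2 ?_
  refine (integrableOn_congr_fun (fun y hy =>
    pow_sub_one_smul_rpow_mul_exp (Module.finrank_pos (R := ℝ) (M := E)) hy) measurableSet_Ioi).2 ?_
  exact integrableOn_rpow_mul_exp_neg_mul_rpow (by linarith) two_pos hb

lemma integral_norm_rpow_mul_exp_neg_mul_sq {p b : ℝ} (hp : 0 ≤ p) (hb : 0 < b) :
    ∫ x : E, ‖x‖ ^ p * Real.exp (-b * ‖x‖ ^ 2)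
      = b ^ (-(p / 2)) * Real.Gamma ((Module.finrank ℝ E : ℝ) / 2 + p / 2)
          / Real.Gamma ((Module.finrank ℝ E : ℝ) / 2)
          * ∫ x : E, Real.exp (-b * ‖x‖ ^ 2) := by
  have hd : (1 : ℝ) ≤ Module.finrank ℝ E := by exact_mod_cast Module.finrank_pos (R := ℝ) (M := E)
  have radial : ∀ q : ℝ, 0 ≤ q → ∫ x : E, ‖x‖ ^ q * Real.exp (-b * ‖x‖ ^ 2)
      = Module.finrank ℝ E • (volume : Measure E).real (ball 0 1) •
        (b ^ (-((Module.finrank ℝ E : ℝ) / 2)) * b ^ (-(q / 2)) * (1 / 2)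
          * Real.Gamma ((Module.finrank ℝ E : ℝ) / 2 + q / 2)) := by
    intro q hq
    rw [integral_fun_norm_addHaar (E := E) volume
      (fun y : ℝ => y ^ q * Real.exp (-b * y ^ 2)),
      setIntegral_congr_fun measurableSet_Ioi
        (fun y hy => pow_sub_one_smul_rpow_mul_exp (Module.finrank_pos (R := ℝ) (M := E)) hy),
      integral_rpow_mul_exp_neg_mul_rpow two_pos (by linarith) hb, ← Real.rpow_add hb]
    congr 3
    · congr 2; ring
    · congr 1; ring
  have hG : Real.Gamma ((Module.finrank ℝ E : ℝ) / 2) ≠ 0 :=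
    (Real.Gamma_pos_of_pos (by linarith)).ne'
  have h0 := radial 0 le_rfl
  simp only [Real.rpow_zero, one_mul, zero_div, neg_zero, mul_one, add_zero] at h0
  rw [radial p hp, h0]
  simp only [nsmul_eq_mul, smul_eq_mul]
  field_simp

end GaussianMoments

/-- The density `(2/(πγ²))^{d/2} exp(-2‖u‖²/γ²)` of the centred Gaussian with covariance
`γ²/4` times the identity. -/
noncomputable def gaussDensity (d : ℕ) (γ : ℝ) (u : EuclideanSpace ℝ (Fin d)) : ℝ :=
  ((Real.pi / (2 / γ ^ 2)) ^ ((d : ℝ) / 2))⁻¹ * Real.exp (-(2 / γ ^ 2) * ‖u‖ ^ 2)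

lemma gaussDensity_nonneg (d : ℕ) (γ : ℝ) (u : EuclideanSpace ℝ (Fin d)) :
    0 ≤ gaussDensity d γ u := by
  unfold gaussDensity; positivity

lemma gaussK_mul_normalization {d : ℕ} {γ : ℝ} (hγ : 0 < γ) (u : EuclideanSpace ℝ (Fin d)) :
    gaussK d γ u * (Real.pi * γ ^ 2) ^ (-(d : ℝ) / 4) = gaussDensity d γ u := by
  have hπ := Real.pi_pos
  have hs : (Real.pi * γ ^ 2) ^ (-(d : ℝ) / 4) = ((Real.sqrt Real.pi * γ) ^ ((d : ℝ) / 2))⁻¹ := by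
    have h : Real.pi * γ ^ 2 = (Real.sqrt Real.pi * γ) ^ (2 : ℝ) := by
      rw [Real.rpow_two, mul_pow, Real.sq_sqrt hπ.le]
    rw [h, ← Real.rpow_mul (by positivity), ← Real.rpow_neg (by positivity)]
    congr 1; ring
  have hc : (2 / (Real.sqrt Real.pi * γ)) ^ ((d : ℝ) / 2)
      * ((Real.sqrt Real.pi * γ) ^ ((d : ℝ) / 2))⁻¹
      = ((Real.pi / (2 / γ ^ 2)) ^ ((d : ℝ) / 2))⁻¹ := by
    rw [← Real.inv_rpow (by positivity), ← Real.inv_rpow (by positivity),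
      ← Real.mul_rpow (by positivity) (by positivity)]
    congr 1
    field_simp
    rw [Real.sq_sqrt hπ.le]
  unfold gaussK gaussDensity
  rw [hs, mul_right_comm, hc]
  congr 2; ring

lemma integrable_gaussDensity {d : ℕ} {γ : ℝ} (hd : 1 ≤ d) (hγ : 0 < γ) :
    Integrable (gaussDensity d γ) := by
  have : Nonempty (Fin d) := ⟨⟨0, hd⟩⟩
  have h := integrable_norm_rpow_mul_exp_neg_mul_sq (E := EuclideanSpace ℝ (Fin d))
    le_rfl (show 0 < 2 / γ ^ 2 by positivity)
  simp only [Real.rpow_zero, one_mul] at h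
  exact h.const_mul _

lemma integral_gaussDensity {d : ℕ} {γ : ℝ} (hγ : 0 < γ) : ∫ u, gaussDensity d γ u = 1 := by
  have hπ := Real.pi_pos
  unfold gaussDensity
  rw [integral_const_mul, GaussianFourier.integral_rexp_neg_mul_sq_norm (by positivity),
    finrank_euclideanSpace_fin]
  exact inv_mul_cancel₀ (by positivity)

lemma integrable_norm_rpow_mul_gaussDensity {d : ℕ} {γ p : ℝ} (hd : 1 ≤ d) (hγ : 0 < γ)
    (hp : 0 ≤ p) : Integrable fun u => ‖u‖ ^ p * gaussDensity d γ u := by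
  have : Nonempty (Fin d) := ⟨⟨0, hd⟩⟩
  refine ((integrable_norm_rpow_mul_exp_neg_mul_sq (E := EuclideanSpace ℝ (Fin d))
    hp (show 0 < 2 / γ ^ 2 by positivity)).const_mul
      ((Real.pi / (2 / γ ^ 2)) ^ ((d : ℝ) / 2))⁻¹).congr (.of_forall fun u => ?_)
  simp only [gaussDensity]; ring

lemma integral_norm_rpow_mul_gaussDensity {d : ℕ} {γ ξ : ℝ} (hd : 1 ≤ d) (hγ : 0 < γ)
    (hξ : 0 ≤ ξ) :
    ∫ u, ‖u‖ ^ (2 * ξ) * gaussDensity d γ u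
      = (2 : ℝ) ^ (-ξ) * Real.Gamma ((d : ℝ) / 2 + ξ) / Real.Gamma ((d : ℝ) / 2)
        * γ ^ (2 * ξ) := by
  have : Nonempty (Fin d) := ⟨⟨0, hd⟩⟩
  have h1 := integral_gaussDensity (d := d) hγ
  unfold gaussDensity at h1 ⊢
  rw [integral_const_mul] at h1
  simp_rw [mul_left_comm (‖_‖ ^ (2 * ξ))]
  rw [integral_const_mul, integral_norm_rpow_mul_exp_neg_mul_sq (by positivity) (by positivity),
    mul_left_comm, h1, finrank_euclideanSpace_fin, mul_one, mul_div_cancel_left₀ ξ two_ne_zero,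
    Real.div_rpow two_pos.le (by positivity), Real.rpow_neg (x := γ ^ 2) (by positivity),
    ← Real.rpow_natCast γ 2, ← Real.rpow_mul hγ.le, div_inv_eq_mul]
  push_cast
  ring

lemma convK_plateauFun {d : ℕ} {γ : ℝ} (hγ : 0 < γ) (ρ : ℝ) (z : EuclideanSpace ℝ (Fin d))
    (C : Set (EuclideanSpace ℝ (Fin d))) (x : EuclideanSpace ℝ (Fin d)) :
    convK d γ (plateauFun d γ ρ z C) x
      = ∫ y, (closedBall z ρ ∩ C).indicator (fun y => gaussDensity d γ (x - y)) y := by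
  unfold convK plateauFun
  congr 1 with y
  rw [← mul_assoc, gaussK_mul_normalization hγ]
  by_cases h : y ∈ closedBall z ρ ∩ C <;> simp [h]

/-- Convolving the plateau function with `K_γ` reproduces `1` inside the plateau, up to a Gaussian
tail controlled by its moment of order `2ξ`. -/
lemma abs_convK_plateauFun_sub_one_le {d : ℕ} {γ ω r ξ : ℝ} (hd : 1 ≤ d) (hγ : 0 < γ)
    (hω : 0 < ω) (hξ : 0 ≤ ξ) {z x : EuclideanSpace ℝ (Fin d)} (hx : x ∈ closedBall z r)
    {C : Set (EuclideanSpace ℝ (Fin d))} (hC : MeasurableSet C)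
    (hfull : volume (closedBall z (ω + r) \ C) = 0) :
    |convK d γ (plateauFun d γ (ω + r) z C) x - 1|
      ≤ (2 : ℝ) ^ (-ξ) * Real.Gamma ((d : ℝ) / 2 + ξ) / Real.Gamma ((d : ℝ) / 2)
        * (γ / ω) ^ (2 * ξ) := by
  set S := closedBall z (ω + r) ∩ C
  have hS : MeasurableSet S := measurableSet_closedBall.inter hC
  have hint : Integrable fun y => gaussDensity d γ (x - y) :=
    (integrable_gaussDensity hd hγ).comp_sub_left x
  have hone : ∫ y, gaussDensity d γ (x - y) = 1 := by
    rw [integral_sub_left_eq_self (gaussDensity d γ) volume x, integral_gaussDensity hγ]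
  have hcompl : 1 - convK d γ (plateauFun d γ (ω + r) z C) x
      = ∫ y in Sᶜ, gaussDensity d γ (x - y) := by
    rw [convK_plateauFun hγ, integral_indicator hS, ← hone, ← integral_add_compl hS hint]
    ring
  have htail : ∫ y in Sᶜ, gaussDensity d γ (x - y)
      ≤ ∫ y, (ω ^ (2 * ξ))⁻¹ * (‖x - y‖ ^ (2 * ξ) * gaussDensity d γ (x - y)) := by
    rw [← integral_indicator hS.compl]
    have hmom : Integrable fun y => ‖x - y‖ ^ (2 * ξ) * gaussDensity d γ (x - y) :=
      (integrable_norm_rpow_mul_gaussDensity hd hγ (p := 2 * ξ) (by positivity)).comp_sub_left x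
    refine integral_mono_ae (hint.indicator hS.compl) (hmom.const_mul _) ?_
    filter_upwards [measure_eq_zero_iff_ae_notMem.1 hfull] with y hy
    have hg := gaussDensity_nonneg d γ (x - y)
    by_cases hyS : y ∈ S
    · rw [indicator_of_notMem (by simpa using hyS)]
      positivity
    · rw [indicator_of_mem (by exact hyS)]
      have hyb : y ∉ closedBall z (ω + r) := fun h => hy ⟨h, fun hc => hyS ⟨h, hc⟩⟩
      have hdist : ω ≤ ‖x - y‖ := by
        rw [mem_closedBall, not_le] at hyb
        rw [mem_closedBall] at hx
        have := dist_triangle_left y z x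
        rw [← dist_eq_norm]
        linarith
      rw [← mul_assoc]
      refine le_mul_of_one_le_left hg ?_
      rw [inv_mul_eq_div, one_le_div (by positivity)]
      exact Real.rpow_le_rpow hω.le hdist (by positivity)
  have hmoment : ∫ y, (ω ^ (2 * ξ))⁻¹ * (‖x - y‖ ^ (2 * ξ) * gaussDensity d γ (x - y))
      = (2 : ℝ) ^ (-ξ) * Real.Gamma ((d : ℝ) / 2 + ξ) / Real.Gamma ((d : ℝ) / 2)
        * (γ / ω) ^ (2 * ξ) := by
    rw [integral_const_mul,
      integral_sub_left_eq_self (fun u => ‖u‖ ^ (2 * ξ) * gaussDensity d γ u) volume x,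
      integral_norm_rpow_mul_gaussDensity hd hγ hξ, Real.div_rpow hγ.le hω.le]
    ring
  rw [abs_sub_comm, hcompl, abs_of_nonneg (integral_nonneg fun y => gaussDensity_nonneg d γ _)]
  exact htail.trans hmoment.le

lemma integrable_abs_two_mul_sub_one {E : Type*} [MeasurableSpace E] {X : Set E} {η : E → ℝ}
    (hηm : Measurable η) (hη01 : ∀ x ∈ X, η x ∈ Icc (0 : ℝ) 1) {μ : Measure E}
    [IsFiniteMeasure μ] (hμX : μ Xᶜ = 0) : Integrable (fun x => |2 * η x - 1|) μ := by
  refine Integrable.of_bound (C := 1) (by fun_prop) ?_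
  filter_upwards [measure_eq_zero_iff_ae_notMem.1 hμX] with x hx
  obtain ⟨h0, h1⟩ := hη01 x (by simpa using hx)
  rw [Real.norm_eq_abs, abs_abs, abs_le]
  constructor <;> linarith

/-- The margin-noise bound extends to measurable sets on which the distance to the decision
boundary is at most `s`, rather than strictly less. -/
lemma setIntegral_le_of_deltaEta_le {E : Type*} [PseudoEMetricSpace E] [MeasurableSpace E]
    {X : Set E} {η : E → ℝ} {μ : Measure E} {β c s : ℝ} (hβ : 0 < β) (hs : 0 < s)
    (hint : Integrable (fun x => |2 * η x - 1|) μ)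
    (hMNE : ∀ t : ℝ, 0 < t →
      (∫ x in {x ∈ X | deltaEta X η x < ENNReal.ofReal t}, |2 * η x - 1| ∂μ) ≤ (c * t) ^ β)
    {T : Set E} (hT : T ⊆ {x ∈ X | deltaEta X η x ≤ ENNReal.ofReal s}) :
    ∫ x in T, |2 * η x - 1| ∂μ ≤ (c * s) ^ β := by
  have hlim : Filter.Tendsto (fun t : ℝ => (c * t) ^ β) (nhdsWithin s (Ioi s))
      (nhds ((c * s) ^ β)) :=
    ((continuous_const.mul continuous_id).rpow_const fun _ => Or.inr hβ.le).continuousWithinAt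
  refine ge_of_tendsto hlim ?_
  filter_upwards [self_mem_nhdsWithin] with t ht
  refine le_trans ?_ (hMNE t (hs.trans ht))
  refine setIntegral_mono_set hint.integrableOn (.of_forall fun _ => abs_nonneg _)
    (LE.le.eventuallyLE fun x hx => ?_)
  exact ⟨(hT hx).1, (hT hx).2.trans_lt ((ENNReal.ofReal_lt_ofReal_iff (hs.trans ht)).2 ht)⟩

theorem statement11
    (d : ℕ) (hd : 1 ≤ d) (r ωm : ℝ) (hr : 0 < r) (hωm : 0 < ωm)
    (X : Set (EuclideanSpace ℝ (Fin d))) (hX : MeasurableSet X)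
    (η : EuclideanSpace ℝ (Fin d) → ℝ) (hηm : Measurable η)
    (hη01 : ∀ x ∈ X, η x ∈ Icc (0 : ℝ) 1)
    (μ : Measure (EuclideanSpace ℝ (Fin d))) [IsFiniteMeasure μ] (hμX : μ Xᶜ = 0)
    (β cMNE : ℝ) (hβ : 0 < β) (hcMNE : 0 < cMNE)
    (hMNE : ∀ t : ℝ, 0 < t →
      (∫ x in {x ∈ X | deltaEta X η x < ENNReal.ofReal t}, |2 * η x - 1| ∂μ)
        ≤ (cMNE * t) ^ β)
    (ι : Type) (J : Finset ι) (hJne : J.Nonempty)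
    (A : ι → Set (EuclideanSpace ℝ (Fin d))) (hAmeas : ∀ j ∈ J, MeasurableSet (A j))
    (hdisj : (J : Set ι).PairwiseDisjoint A)
    (z : ι → EuclideanSpace ℝ (Fin d)) (hAz : ∀ j ∈ J, A j ⊆ closedBall (z j) r)
    (σ : ι → ℝ) (C : ι → Set (EuclideanSpace ℝ (Fin d)))
    (hclass : ∀ j ∈ J,
      (A j ∩ {x ∈ X | η x < 1/2} = ∅ ∧ σ j = 1
          ∧ C j = {x ∈ X | 1/2 < η x} ∪ {x ∈ X | η x = 1/2})
      ∨ (A j ∩ {x ∈ X | 1/2 < η x} = ∅ ∧ σ j = -1 ∧ C j = {x ∈ X | η x < 1/2}))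
    (hfull : ∀ j ∈ J, volume (closedBall (z j) (ωm + r) \ C j) = 0)
    (s : ℝ) (hs : 0 < s)
    (hnear : ∀ j ∈ J, A j ⊆ {x ∈ X | deltaEta X η x ≤ ENNReal.ofReal s})
    (γ : ι → ℝ) (hγ : ∀ j ∈ J, 0 < γ j)
    (ξ : ℝ) (hξ : 0 < ξ) :
    ∑ j ∈ J, ∫ x in A j,
        |σ j * convK d (γ j) (plateauFun d (γ j) (ωm + r) (z j) (C j)) x
          - (if 1/2 ≤ η x then (1 : ℝ) else -1)| * |2 * η x - 1| ∂μ
      ≤ (2 : ℝ) ^ (-ξ) * Real.Gamma ((d : ℝ) / 2 + ξ) / Real.Gamma ((d : ℝ) / 2)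
          * (J.sup' hJne γ / ωm) ^ (2 * ξ)
          * (cMNE * s) ^ β := by
  have hint := integrable_abs_two_mul_sub_one hηm hη01 hμX
  have hGpos : 0 < Real.Gamma ((d : ℝ) / 2) := by
    have : (1 : ℝ) ≤ d := by exact_mod_cast hd
    exact Real.Gamma_pos_of_pos (by linarith)
  have hGξpos : 0 < Real.Gamma ((d : ℝ) / 2 + ξ) := Real.Gamma_pos_of_pos (by positivity)
  have hsup : 0 < J.sup' hJne γ := by
    obtain ⟨j, hj⟩ := hJne
    exact (hγ j hj).trans_le (Finset.le_sup' γ hj)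
  set K := (2 : ℝ) ^ (-ξ) * Real.Gamma ((d : ℝ) / 2 + ξ) / Real.Gamma ((d : ℝ) / 2)
  have hK : 0 ≤ K := by positivity
  have hpt : ∀ j ∈ J, ∀ x ∈ A j,
      |σ j * convK d (γ j) (plateauFun d (γ j) (ωm + r) (z j) (C j)) x
          - (if 1/2 ≤ η x then (1 : ℝ) else -1)| * |2 * η x - 1|
        ≤ K * (J.sup' hJne γ / ωm) ^ (2 * ξ) * |2 * η x - 1| := by
    intro j hj x hx
    have hxX : x ∈ X := (hnear j hj hx).1
    have hCm : MeasurableSet (C j) := by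
      rcases hclass j hj with ⟨-, -, h⟩ | ⟨-, -, h⟩ <;> rw [h]
      · exact (hX.inter (measurableSet_lt measurable_const hηm)).union
          (hX.inter (measurableSet_eq_fun hηm measurable_const))
      · exact hX.inter (measurableSet_lt hηm measurable_const)
    have hconv := (abs_convK_plateauFun_sub_one_le hd (hγ j hj) hωm hξ.le (hAz j hj hx) hCm
      (hfull j hj)).trans (mul_le_mul_of_nonneg_left (Real.rpow_le_rpow
        (div_nonneg (hγ j hj).le hωm.le) (div_le_div_of_nonneg_right (Finset.le_sup' γ hj) hωm.le)
        (by positivity : (0 : ℝ) ≤ 2 * ξ)) hK)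
    by_cases hhalf : η x = 1/2
    · simp [hhalf]
    refine mul_le_mul_of_nonneg_right (le_trans (le_of_eq ?_) hconv) (abs_nonneg _)
    rcases hclass j hj with ⟨hA, hσ, -⟩ | ⟨hA, hσ, -⟩
    · have hη : 1/2 ≤ η x := not_lt.1 fun h => (hA ▸ ⟨hx, hxX, h⟩ : x ∈ (∅ : Set _))
      rw [hσ, if_pos hη, one_mul]
    · have hη : ¬ 1/2 ≤ η x := fun h =>
        (hA ▸ ⟨hx, hxX, lt_of_le_of_ne h (Ne.symm hhalf)⟩ : x ∈ (∅ : Set _))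
      rw [hσ, if_neg hη, ← abs_neg]
      congr 1; ring
  calc _ ≤ ∑ j ∈ J, ∫ x in A j, K * (J.sup' hJne γ / ωm) ^ (2 * ξ) * |2 * η x - 1| ∂μ := by
        refine Finset.sum_le_sum fun j hj => ?_
        refine integral_mono_of_nonneg (.of_forall fun x => by positivity)
          (hint.integrableOn.const_mul _) ?_
        exact (ae_restrict_mem (hAmeas j hj)).mono (hpt j hj)
    _ = K * (J.sup' hJne γ / ωm) ^ (2 * ξ) * ∫ x in ⋃ j ∈ J, A j, |2 * η x - 1| ∂μ := by
        rw [integral_biUnion_finset J hAmeas hdisj fun j _ => hint.integrableOn, Finset.mul_sum]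
        simp_rw [integral_const_mul]
    _ ≤ _ := by
        refine mul_le_mul_of_nonneg_left ?_ (by positivity)
        exact setIntegral_le_of_deltaEta_le hβ hs hint hMNE (iUnion₂_subset hnear)
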